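/- Let X be a complex Banach space and let {S_h}, {P_h}, {T_h} be bounded families of operators on X. If {T_h} and {P_h} are asymptotically quasinilpotent equivalent, and {P_h} and {S_h} are asymptotically quasinilpotent equivalent, then {T_h} and {S_h} are asymptotically quasinilpotent equivalent; i.e., asymptotic quasinilpotent equivalence is transitive on bounded families. -/

import Mathlib

open Filter Topology Finset

noncomputable section

/-- The filter of approach `h → 0` within the interval `(0,1]`. -/
def zeroFilter : Filter ℝ := nhdsWithin 0 (Set.Ioc 0 1)

variable {X : Type*} [NormedAddCommGroup X] [NormedSpace ℂ X]

/-- A family of operators `(0,1] ∋ h ↦ S h` is bounded if `sup_{h ∈ (0,1]} ‖S h‖ < ∞`. -/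
def BddFamily (S : ℝ → X →L[ℂ] X) : Prop :=
  ∃ M : ℝ, ∀ h ∈ Set.Ioc (0 : ℝ) 1, ‖S h‖ ≤ M

/-- The bracket `(T - S)^{[n]} = ∑_{k=0}^{n} (-1)^{n-k} C(n,k) T^k S^{n-k}`. -/
def qBr (T S : X →L[ℂ] X) (n : ℕ) : X →L[ℂ] X :=
  ∑ k ∈ Finset.range (n + 1), ((-1 : ℂ) ^ (n - k) * (n.choose k : ℂ)) • (T ^ k * S ^ (n - k))

/-- Two families are asymptotically quasinilpotent equivalent. -/
def AsympQNEquiv (S T : ℝ → X →L[ℂ] X) : Prop :=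
  Tendsto (fun n : ℕ =>
      (Filter.limsup (fun h => ‖qBr (S h) (T h) n‖) zeroFilter) ^ ((n : ℝ)⁻¹))
    atTop (𝓝 0) ∧
  Tendsto (fun n : ℕ =>
      (Filter.limsup (fun h => ‖qBr (T h) (S h) n‖) zeroFilter) ^ ((n : ℝ)⁻¹))
    atTop (𝓝 0)

/-- `R` is an asymptotic resolvent of the family `S` at `l`: a bounded family such that
`(l I - S_h) R_h → I` and `R_h (l I - S_h) → I` in norm as `h → 0`. -/
def IsAsympResolvent (S R : ℝ → X →L[ℂ] X) (l : ℂ) : Prop :=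
  BddFamily R ∧
  Tendsto (fun h => ‖(l • (1 : X →L[ℂ] X) - S h) * R h - 1‖) zeroFilter (𝓝 0) ∧
  Tendsto (fun h => ‖R h * (l • (1 : X →L[ℂ] X) - S h) - 1‖) zeroFilter (𝓝 0)

/-- The resolvent set of a family of operators. -/
def famResolvent (S : ℝ → X →L[ℂ] X) : Set ℂ :=
  {l : ℂ | ∃ R : ℝ → X →L[ℂ] X, IsAsympResolvent S R l}

/-- The spectrum of a family of operators. -/
def famSpectrum (S : ℝ → X →L[ℂ] X) : Set ℂ :=
  (famResolvent S)ᶜ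

theorem qBr_eq_pow_mulLeft_sub_mulRight (T S : X →L[ℂ] X) (n : ℕ) :
    qBr T S n = ((LinearMap.mulLeft ℂ T - LinearMap.mulRight ℂ S) ^ n) 1 := by
  have hneg : LinearMap.mulLeft ℂ T - LinearMap.mulRight ℂ S =
      LinearMap.mulLeft ℂ T + LinearMap.mulRight ℂ (-S) := by
    ext1 A
    simp [sub_eq_add_neg]
  have hc : Commute (LinearMap.mulLeft ℂ T) (LinearMap.mulRight ℂ (-S)) :=
    LinearMap.commute_mulLeft_right ..
  rw [hneg, hc.add_pow', LinearMap.sum_apply, qBr,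
    Finset.Nat.sum_antidiagonal_eq_sum_range_succ_mk]
  refine Finset.sum_congr rfl fun k _ => ?_
  rw [LinearMap.smul_apply, Module.End.mul_apply, LinearMap.pow_mulLeft, LinearMap.pow_mulRight,
    LinearMap.mulRight_apply, LinearMap.mulLeft_apply, one_mul, mul_comm, mul_smul,
    Nat.cast_smul_eq_nsmul]
  rcases Nat.even_or_odd (n - k) with h | h <;> simp [h.neg_one_pow, h.neg_pow]

theorem qBr_zero (T S : X →L[ℂ] X) : qBr T S 0 = 1 := by
  simp [qBr]

theorem qBr_succ (T S : X →L[ℂ] X) (n : ℕ) :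
    qBr T S (n + 1) = T * qBr T S n - qBr T S n * S := by
  simp [qBr_eq_pow_mulLeft_sub_mulRight, pow_succ']

/-- The binomial convolution identity for the brackets. -/
theorem qBr_eq_sum_antidiagonal (T P S : X →L[ℂ] X) (n : ℕ) :
    qBr T S n = ∑ ij ∈ antidiagonal n, n.choose ij.1 • (qBr T P ij.1 * qBr P S ij.2) := by
  induction n with
  | zero => simp [qBr_zero]
  | succ n ih =>
    rw [qBr_succ, ih,
      Finset.sum_antidiagonal_choose_succ_nsmul (fun i j => qBr T P i * qBr P S j) n,
      ← Finset.sum_add_distrib, Finset.mul_sum, Finset.sum_mul, ← Finset.sum_sub_distrib]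
    refine Finset.sum_congr rfl fun ij hij => ?_
    rw [Nat.choose_symm_of_eq_add (HasAntidiagonal.mem_antidiagonal.1 hij).symm, ← smul_add,
      mul_smul_comm, smul_mul_assoc, ← smul_sub, qBr_succ, qBr_succ]
    congr 1
    noncomm_ring

theorem norm_qBr_le (T S : X →L[ℂ] X) (n : ℕ) : ‖qBr T S n‖ ≤ (‖T‖ + ‖S‖) ^ n := by
  induction n with
  | zero =>
    rw [qBr_zero, pow_zero]
    exact ContinuousLinearMap.norm_id_le
  | succ n ih =>
    calc ‖qBr T S (n + 1)‖ ≤ ‖T‖ * ‖qBr T S n‖ + ‖qBr T S n‖ * ‖S‖ := by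
          rw [qBr_succ]
          exact (norm_sub_le _ _).trans (add_le_add (norm_mul_le _ _) (norm_mul_le _ _))
      _ = (‖T‖ + ‖S‖) * ‖qBr T S n‖ := by ring
      _ ≤ (‖T‖ + ‖S‖) * (‖T‖ + ‖S‖) ^ n := by gcongr
      _ = (‖T‖ + ‖S‖) ^ (n + 1) := by ring

theorem zeroFilter_neBot : zeroFilter.NeBot := by
  rw [zeroFilter, nhdsWithin_Ioc_eq_nhdsGT zero_lt_one]
  infer_instance

theorem BddFamily.isBoundedUnder_norm_qBr {T S : ℝ → X →L[ℂ] X} (hT : BddFamily T)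
    (hS : BddFamily S) (n : ℕ) :
    zeroFilter.IsBoundedUnder (· ≤ ·) fun h => ‖qBr (T h) (S h) n‖ := by
  obtain ⟨M, hM⟩ := hT
  obtain ⟨N, hN⟩ := hS
  refine isBoundedUnder_of_eventually_le (a := (M + N) ^ n) ?_
  filter_upwards [self_mem_nhdsWithin] with h hh
  exact (norm_qBr_le _ _ n).trans (by gcongr; exacts [hM h hh, hN h hh])

/-- The `n`-th roots of the upper limits of `f n` tend to zero if and only if `f n` is eventually
dominated by every geometric sequence, up to a constant. -/
theorem tendsto_limsup_rpow_inv_zero_iff {α : Type*} {F : Filter α} [F.NeBot] {f : ℕ → α → ℝ}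
    (hf : ∀ n a, 0 ≤ f n a) (hb : ∀ n, F.IsBoundedUnder (· ≤ ·) (f n)) :
    Tendsto (fun n : ℕ => (limsup (f n) F) ^ ((n : ℝ)⁻¹)) atTop (𝓝 0) ↔
      ∀ ε > 0, ∃ C > 0, ∀ n, ∀ᶠ a in F, f n a ≤ C * ε ^ n := by
  have hnonneg (n : ℕ) : 0 ≤ limsup (f n) F :=
    le_limsup_of_frequently_le (Eventually.of_forall (hf n)).frequently (hb n)
  constructor
  · intro h ε hε
    have hO : (fun n => limsup (f n) F) =O[atTop] fun n : ℕ => ε ^ n := by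
      refine Asymptotics.IsBigO.of_bound 1 ?_
      filter_upwards [h.eventually_lt_const hε, eventually_ge_atTop 1] with n hn hn1
      rw [Real.norm_of_nonneg (hnonneg n), Real.norm_of_nonneg (by positivity), one_mul]
      have hn0 : n ≠ 0 := by omega
      calc limsup (f n) F = ((limsup (f n) F) ^ ((n : ℝ)⁻¹)) ^ n :=
            (Real.rpow_inv_natCast_pow (hnonneg n) hn0).symm
        _ ≤ ε ^ n := pow_le_pow_left₀ (Real.rpow_nonneg (hnonneg n) _) hn.le n
    obtain ⟨C, hC, hle⟩ := Asymptotics.bound_of_isBigO_nat_atTop hO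
    refine ⟨C + 1, by positivity, fun n => ?_⟩
    have hεn : 0 < ε ^ n := by positivity
    have hn := hle hεn.ne'
    rw [Real.norm_of_nonneg (hnonneg n), Real.norm_of_nonneg hεn.le] at hn
    exact (eventually_lt_of_limsup_lt (show limsup (f n) F < (C + 1) * ε ^ n by linarith)
      (hb n)).mono fun _ => le_of_lt
  · intro h
    refine tendsto_order.2 ⟨fun a ha => Eventually.of_forall fun n =>
      ha.trans_le (Real.rpow_nonneg (hnonneg n) _), fun ε hε => ?_⟩
    obtain ⟨C, hC, hle⟩ := h (ε / 2) (by positivity)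
    have hlim : Tendsto (fun n : ℕ => C ^ ((n : ℝ)⁻¹) * (ε / 2)) atTop (𝓝 (ε / 2)) := by
      have hroot := tendsto_const_nhds (x := C) |>.rpow
        (tendsto_inv_atTop_nhds_zero_nat (𝕜 := ℝ)) (Or.inl hC.ne')
      simpa using hroot.mul_const (ε / 2)
    filter_upwards [hlim.eventually_lt_const (half_lt_self hε), eventually_ge_atTop 1]
      with n hn hn1
    refine lt_of_le_of_lt ?_ hn
    have hn0 : n ≠ 0 := by omega
    have hlimsup : limsup (f n) F ≤ C * (ε / 2) ^ n :=
      limsup_le_of_le (isCoboundedUnder_le_of_le F (hf n)) (hle n)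
    calc (limsup (f n) F) ^ ((n : ℝ)⁻¹) ≤ (C * (ε / 2) ^ n) ^ ((n : ℝ)⁻¹) :=
          Real.rpow_le_rpow (hnonneg n) hlimsup (by positivity)
      _ = C ^ ((n : ℝ)⁻¹) * (ε / 2) := by
          rw [Real.mul_rpow hC.le (by positivity), Real.pow_rpow_inv_natCast (by positivity) hn0]

theorem norm_qBr_le_of_forall_le {T P S : X →L[ℂ] X} {C D ε : ℝ} {n : ℕ} (hC : 0 ≤ C)
    (hε : 0 ≤ ε) (hTP : ∀ k ≤ n, ‖qBr T P k‖ ≤ C * ε ^ k)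
    (hPS : ∀ k ≤ n, ‖qBr P S k‖ ≤ D * ε ^ k) : ‖qBr T S n‖ ≤ C * D * (2 * ε) ^ n := by
  rw [qBr_eq_sum_antidiagonal T P S]
  calc _ ≤ ∑ ij ∈ antidiagonal n, n.choose ij.1 * (C * D * ε ^ n) := by
        refine norm_sum_le_of_le _ fun ij hij => ?_
        have hsum := HasAntidiagonal.mem_antidiagonal.1 hij
        rw [← Nat.cast_smul_eq_nsmul ℝ, norm_smul, Real.norm_natCast]
        gcongr
        calc _ ≤ ‖qBr T P ij.1‖ * ‖qBr P S ij.2‖ := norm_mul_le _ _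
          _ ≤ (C * ε ^ ij.1) * (D * ε ^ ij.2) :=
              mul_le_mul (hTP _ (by omega)) (hPS _ (by omega)) (norm_nonneg _) (by positivity)
          _ = C * D * ε ^ n := by rw [← hsum, pow_add]; ring
    _ = C * D * (2 * ε) ^ n := by
        rw [← Finset.sum_mul, Finset.Nat.sum_antidiagonal_eq_sum_range_succ_mk, ← Nat.cast_sum,
          Nat.sum_range_choose, mul_pow]
        push_cast
        ring

theorem tendsto_limsup_norm_qBr_trans {T P S : ℝ → X →L[ℂ] X} (hT : BddFamily T)
    (hP : BddFamily P) (hS : BddFamily S)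
    (hTP : Tendsto (fun n : ℕ =>
      (limsup (fun h => ‖qBr (T h) (P h) n‖) zeroFilter) ^ ((n : ℝ)⁻¹)) atTop (𝓝 0))
    (hPS : Tendsto (fun n : ℕ =>
      (limsup (fun h => ‖qBr (P h) (S h) n‖) zeroFilter) ^ ((n : ℝ)⁻¹)) atTop (𝓝 0)) :
    Tendsto (fun n : ℕ =>
      (limsup (fun h => ‖qBr (T h) (S h) n‖) zeroFilter) ^ ((n : ℝ)⁻¹)) atTop (𝓝 0) := by
  have := zeroFilter_neBot
  rw [tendsto_limsup_rpow_inv_zero_iff (fun _ _ => norm_nonneg _)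
    (hT.isBoundedUnder_norm_qBr hP)] at hTP
  rw [tendsto_limsup_rpow_inv_zero_iff (fun _ _ => norm_nonneg _)
    (hP.isBoundedUnder_norm_qBr hS)] at hPS
  rw [tendsto_limsup_rpow_inv_zero_iff (fun _ _ => norm_nonneg _)
    (hT.isBoundedUnder_norm_qBr hS)]
  intro ε hε
  obtain ⟨C, hC, hCle⟩ := hTP (ε / 2) (by positivity)
  obtain ⟨D, hD, hDle⟩ := hPS (ε / 2) (by positivity)
  refine ⟨C * D, by positivity, fun n => ?_⟩
  filter_upwards [(Set.finite_Iic n).eventually_all.2 fun k _ => hCle k,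
    (Set.finite_Iic n).eventually_all.2 fun k _ => hDle k] with h h₁ h₂
  simpa [mul_div_cancel₀] using norm_qBr_le_of_forall_le hC.le (by positivity) h₁ h₂

theorem stmt14 {X : Type*} [NormedAddCommGroup X] [NormedSpace ℂ X] [CompleteSpace X]
    (S P T : ℝ → X →L[ℂ] X) (hS : BddFamily S) (hP : BddFamily P) (hT : BddFamily T)
    (hTP : AsympQNEquiv T P) (hPS : AsympQNEquiv P S) :
    AsympQNEquiv T S :=
  ⟨tendsto_limsup_norm_qBr_trans hT hP hS hTP.1 hPS.1,
    tendsto_limsup_norm_qBr_trans hS hP hT hPS.2 hTP.2⟩
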